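/- arXiv:1604.01128 — 2 statements merged into one kernel-verified Lean document; each statement's English description precedes it below -/
import Mathlib

section
/- Let λ ∈ ℂ with Re(λ) = 0. There exists a three times continuously differentiable function φ : [0,L] → ℂ, not identically zero, satisfying −(φ'(x) + φ'''(x)) = λ·φ(x) for all x ∈ [0,L] together with φ(0) = φ(L) = 0 and φ'(L) = 0, if and only if λ = i·q or λ = −i·q. Moreover, any such φ corresponding to λ = i·q is a complex scalar multiple of φ1 − i·φ2, and any such φ corresponding to λ = −i·q is a complex scalar multiple of φ1 + i·φ2. -/
noncomputable def L : ℝ := 2 * Real.pi * Real.sqrt (7 / 3)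

noncomputable def q : ℝ := 20 / (21 * Real.sqrt 21)

noncomputable def Θ : ℝ := (1 / Real.sqrt (14 * Real.pi)) * (3 / 7 : ℝ) ^ ((1 : ℝ) / 4)

noncomputable def φ1 (x : ℝ) : ℝ :=
  Θ * (Real.cos (5 * x / Real.sqrt 21) - 3 * Real.cos (x / Real.sqrt 21)
      + 2 * Real.cos (4 * x / Real.sqrt 21))

noncomputable def φ2 (x : ℝ) : ℝ :=
  Θ * (-Real.sin (5 * x / Real.sqrt 21) - 3 * Real.sin (x / Real.sqrt 21)
      + 2 * Real.sin (4 * x / Real.sqrt 21))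


/-- φ is a (nonzero, C³ on [0,L]) eigenfunction of φ ↦ −φ' − φ''' with boundary
conditions φ(0) = φ(L) = 0, φ'(L) = 0, for the eigenvalue `lam`. -/
def IsEigenfunction (lam : ℂ) (φ : ℝ → ℂ) : Prop :=
  ContDiffOn ℝ 3 φ (Set.Icc 0 L) ∧
  (∃ x ∈ Set.Icc (0 : ℝ) L, φ x ≠ 0) ∧
  (∀ x ∈ Set.Icc (0 : ℝ) L,
    -(iteratedDerivWithin 1 φ (Set.Icc 0 L) x + iteratedDerivWithin 3 φ (Set.Icc 0 L) x)
      = lam * φ x) ∧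
  φ 0 = 0 ∧ φ L = 0 ∧ iteratedDerivWithin 1 φ (Set.Icc 0 L) L = 0

lemma L_pos : 0 < L := by
  unfold L; positivity

lemma L_eq : L * Real.sqrt 21 = 14 * Real.pi := by
  unfold L
  rw [mul_assoc, ← Real.sqrt_mul (by norm_num), show (7 / 3 * 21 : ℝ) = 7 ^ 2 by norm_num,
    Real.sqrt_sq (by norm_num)]
  ring

lemma Th_pos : 0 < Θ := by
  unfold Θ; positivity

/-- a function with vanishing derivative on `[0,L]` is constant -/
lemma const_of_deriv (g : ℝ → ℂ)
    (hg : ∀ x ∈ Set.Icc (0 : ℝ) L, HasDerivWithinAt g 0 (Set.Icc 0 L) x) :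
    ∀ x ∈ Set.Icc (0 : ℝ) L, g x = g 0 := by
  apply constant_of_derivWithin_zero
  · exact fun x hx => (hg x hx).differentiableWithinAt
  · intro x hx
    have hx' : x ∈ Set.Icc (0 : ℝ) L := ⟨hx.1, hx.2.le⟩
    exact (hg x hx').derivWithin (uniqueDiffOn_Icc L_pos x hx')

lemma hasDeriv_exp (r : ℂ) (x : ℝ) :
    HasDerivAt (fun x : ℝ => Complex.exp (r * x)) (r * Complex.exp (r * x)) x := by
  have h := ((Complex.ofRealCLM.hasDerivAt (x := x)).const_mul r).cexp
  simpa [mul_comm] using h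

/-- first order linear equation -/
lemma first_order (g : ℝ → ℂ) (r : ℂ)
    (hg : ∀ x ∈ Set.Icc (0 : ℝ) L, HasDerivWithinAt g (r * g x) (Set.Icc 0 L) x) :
    ∀ x ∈ Set.Icc (0 : ℝ) L, g x = g 0 * Complex.exp (r * x) := by
  intro x hx
  have h := const_of_deriv (fun x => g x * Complex.exp (-r * x)) (by
    intro x hx
    have := (hg x hx).mul (hasDeriv_exp (-r) x).hasDerivWithinAt
    refine HasDerivWithinAt.congr_deriv this ?_
    ring) x hx
  simp only [Complex.ofReal_zero, mul_zero, Complex.exp_zero, mul_one] at h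
  rw [← h, mul_assoc, ← Complex.exp_add]
  simp

lemma derivs (φ : ℝ → ℂ) (h : ContDiffOn ℝ 3 φ (Set.Icc 0 L)) (n : ℕ) (hn : n < 3)
    (x : ℝ) (hx : x ∈ Set.Icc (0 : ℝ) L) :
    HasDerivWithinAt (iteratedDerivWithin n φ (Set.Icc 0 L))
      (iteratedDerivWithin (n + 1) φ (Set.Icc 0 L) x) (Set.Icc 0 L) x := by
  have h1 := h.differentiableOn_iteratedDerivWithin (m := n) (by exact_mod_cast hn)
    (uniqueDiffOn_Icc L_pos)
  rw [iteratedDerivWithin_succ]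
  exact (h1 x hx).hasDerivWithinAt

lemma key (lam : ℂ) (hre : lam.re = 0) (φ : ℝ → ℂ) (h : IsEigenfunction lam φ) :
    ∃ (A B : ℂ) (f1 f2 : ℝ → ℂ), φ 0 = 0 ∧ (∃ x ∈ Set.Icc (0 : ℝ) L, φ x ≠ 0) ∧
      (∀ x ∈ Set.Icc (0 : ℝ) L, HasDerivWithinAt φ (f1 x) (Set.Icc 0 L) x) ∧
      ∀ r : ℂ, r ^ 3 + r + lam = 0 →
        (∀ x ∈ Set.Icc (0 : ℝ) L,
          f2 x + r * f1 x + (r ^ 2 + 1) * φ x = A * Complex.exp (r * x)) ∧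
        B = A * Complex.exp (r * L) := by
  obtain ⟨hc, hne, hode, h0, hL, hL1⟩ := h
  have d0 : ∀ x ∈ Set.Icc (0 : ℝ) L, HasDerivWithinAt φ
      (iteratedDerivWithin 1 φ (Set.Icc 0 L) x) (Set.Icc 0 L) x := by
    intro x hx
    have := derivs φ hc 0 (by norm_num) x hx
    rwa [iteratedDerivWithin_zero] at this
  have d1 := derivs φ hc 1 (by norm_num)
  have d2 := derivs φ hc 2 (by norm_num)
  simp only [Nat.reduceAdd] at d1 d2
  set f1 := iteratedDerivWithin 1 φ (Set.Icc 0 L) with hf1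
  set f2 := iteratedDerivWithin 2 φ (Set.Icc 0 L) with hf2
  set f3 := iteratedDerivWithin 3 φ (Set.Icc 0 L) with hf3
  have m0 : (0 : ℝ) ∈ Set.Icc (0 : ℝ) L := ⟨le_rfl, L_pos.le⟩
  have mL : L ∈ Set.Icc (0 : ℝ) L := ⟨L_pos.le, le_rfl⟩
  have hlam : star lam = -lam := by
    apply Complex.ext <;> simp [hre]
  -- energy identity
  have hE := const_of_deriv (fun x => f2 x * star (φ x) + star (f2 x) * φ x
      - f1 x * star (f1 x) + φ x * star (φ x)) (by
    intro x hx
    have e0 := d0 x hx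
    have e1 := d1 x hx
    have e2 := d2 x hx
    have := (((e2.mul e0.star).add (e2.star.mul e0)).sub (e1.mul e1.star)).add (e0.mul e0.star)
    refine HasDerivWithinAt.congr_deriv this ?_
    have o1 := hode x hx
    have o2 := congrArg star o1
    simp only [star_neg, star_add, star_mul, hlam] at o2
    linear_combination -(star (φ x)) * o1 - φ x * o2) L mL
  simp only [h0, hL, hL1, star_zero, mul_zero, zero_mul, add_zero, sub_zero, zero_sub] at hE
  have h1 : f1 0 = 0 := by
    have : f1 0 * star (f1 0) = 0 := by linear_combination hE
    rcases mul_eq_zero.1 this with h | h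
    · exact h
    · exact star_eq_zero.1 h
  refine ⟨f2 0, f2 L, f1, f2, h0, hne, d0, ?_⟩
  intro r hr
  have hg := first_order (fun x => f2 x + r * f1 x + (r ^ 2 + 1) * φ x) r (by
    intro x hx
    have e0 := d0 x hx
    have e1 := d1 x hx
    have e2 := d2 x hx
    have := (e2.add (e1.const_mul r)).add (e0.const_mul (r ^ 2 + 1))
    refine HasDerivWithinAt.congr_deriv this ?_
    have o1 := hode x hx
    linear_combination -(φ x) * hr - o1)
  simp only [h0, h1, mul_zero, add_zero] at hg
  refine ⟨hg, ?_⟩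
  have := hg L mL
  rw [hL, hL1] at this
  simpa using this

lemma formula (φ f1 f2 : ℝ → ℂ) (A a b c : ℂ) (x : ℝ)
    (ha : f2 x + a * f1 x + (a ^ 2 + 1) * φ x = A * Complex.exp (a * x))
    (hb : f2 x + b * f1 x + (b ^ 2 + 1) * φ x = A * Complex.exp (b * x))
    (hc : f2 x + c * f1 x + (c ^ 2 + 1) * φ x = A * Complex.exp (c * x)) :
    (a - b) * (a - c) * (b - c) * φ x = A * ((b - c) * Complex.exp (a * x)
      - (a - c) * Complex.exp (b * x) + (a - b) * Complex.exp (c * x)) := by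
  linear_combination (b - c) * ha - (a - c) * hb + (a - b) * hc

lemma no_double (lam : ℂ) (hre : lam.re = 0) (φ : ℝ → ℂ) (h : IsEigenfunction lam φ)
    (r : ℂ) (hr : r ^ 3 + r + lam = 0) (hd : 3 * r ^ 2 + 1 = 0) : False := by
  obtain ⟨A, B, f1, f2, h0, ⟨x0, hx0, hne⟩, d0, hk⟩ := key lam hre φ h
  obtain ⟨k1, k1'⟩ := hk r hr
  obtain ⟨k2, k2'⟩ := hk (-2 * r) (by linear_combination hr - 3 * r * hd)
  have r0 : r ≠ 0 := by rintro rfl; norm_num at hd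
  by_cases hA : A = 0
  · have := first_order φ r (by
      intro x hx
      convert d0 x hx using 1
      have e1 := k1 x hx
      have e2 := k2 x hx
      rw [hA] at e1 e2
      have : 3 * r * (f1 x - r * φ x) = 0 := by
        linear_combination e1 - e2 - (2 * φ x * 0 + φ x * 0) * hd
      rcases mul_eq_zero.1 this with h | h
      · exact absurd h (by simpa using r0)
      · linear_combination -h) x0 hx0
    rw [h0] at this
    exact hne (by simpa using this)
  · have he : Complex.exp (r * L) = Complex.exp (-2 * r * L) :=
      mul_left_cancel₀ hA (k1'.symm.trans k2')
    obtain ⟨n, hn⟩ := Complex.exp_eq_exp_iff_exists_int.1 he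
    -- 3 r L = 2 π i n
    have h3 : 3 * r * L = n * (2 * Real.pi * Complex.I) := by linear_combination hn
    have hLs : L ^ 2 * 3 = 28 * Real.pi ^ 2 := by
      unfold L
      rw [mul_pow, Real.sq_sqrt (by norm_num)]; ring
    have hLc : (L : ℂ) ^ 2 * 3 = 28 * (Real.pi : ℂ) ^ 2 := by exact_mod_cast hLs
    have hpi : (Real.pi : ℂ) ≠ 0 := by exact_mod_cast Real.pi_ne_zero
    have h7 : (n : ℂ) ^ 2 = 7 := by
      have : (4 * (Real.pi : ℂ) ^ 2) * ((n : ℂ) ^ 2 - 7) = 0 := by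
        linear_combination (3 * r * L + n * (2 * Real.pi * Complex.I)) * h3
          - 3 * L ^ 2 * hd + hLc + 4 * n ^ 2 * Real.pi ^ 2 * Complex.I_sq
      rcases mul_eq_zero.1 this with h | h
      · exact absurd h (by simpa using hpi)
      · linear_combination h
    have h7' : n ^ 2 = 7 := by exact_mod_cast h7
    have : n ≤ 2 := by nlinarith
    have : -2 ≤ n := by nlinarith
    interval_cases n <;> omega

lemma int_sol (m n : ℤ) (h : m ^ 2 + m * n + n ^ 2 = 7) (hm : m ≠ 0) (hn : n ≠ 0)
    (hmn : m + n ≠ 0) :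
    (2 * m + n) * (21 - (2 * m + n) ^ 2) = 20 ∨ (2 * m + n) * (21 - (2 * m + n) ^ 2) = -20 := by
  have h1 : m ≤ 3 := by nlinarith [sq_nonneg (m + 2 * n)]
  have h2 : -3 ≤ m := by nlinarith [sq_nonneg (m + 2 * n)]
  have h3 : n ≤ 3 := by nlinarith [sq_nonneg (2 * m + n)]
  have h4 : -3 ≤ n := by nlinarith [sq_nonneg (2 * m + n)]
  interval_cases m <;> interval_cases n <;> simp_all

lemma w_facts : ∃ w : ℂ, w = Complex.I / (Real.sqrt 21 : ℂ) ∧ 21 * w ^ 2 = -1 ∧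
    21 * (Complex.I * (q : ℂ)) = 20 * w ∧ 3 * w * L = 2 * Real.pi * Complex.I := by
  have hs : (Real.sqrt 21 : ℂ) ^ 2 = 21 := by
    rw [← Complex.ofReal_pow, Real.sq_sqrt (by norm_num)]; norm_num
  have hs0 : (Real.sqrt 21 : ℂ) ≠ 0 := by
    intro h; rw [h] at hs; norm_num at hs
  refine ⟨_, rfl, ?_, ?_, ?_⟩
  · rw [div_pow, hs, Complex.I_sq]; norm_num
  · unfold q; push_cast; field_simp
  · have : (L : ℂ) * (Real.sqrt 21 : ℂ) = 14 * Real.pi := by exact_mod_cast L_eq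
    field_simp
    have h2 : (L : ℂ) * 21 = 14 * Real.pi * (Real.sqrt 21 : ℂ) := by
      linear_combination (Real.sqrt 21 : ℂ) * this - L * hs
    linear_combination h2 / 7

lemma forward (lam : ℂ) (hre : lam.re = 0) (φ : ℝ → ℂ) (h : IsEigenfunction lam φ) :
    lam = Complex.I * (q : ℂ) ∨ lam = -Complex.I * (q : ℂ) := by
  obtain ⟨w, -, hw, hq, hwL⟩ := w_facts
  have w0 : w ≠ 0 := by rintro rfl; norm_num at hw
  -- roots
  obtain ⟨a, ha⟩ : ∃ a : ℂ, a ^ 3 + a + lam = 0 := by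
    obtain ⟨a, ha⟩ := IsAlgClosed.exists_root
      (Polynomial.X ^ 3 + Polynomial.X + Polynomial.C lam : Polynomial ℂ) (by
        have : (Polynomial.X ^ 3 + Polynomial.X + Polynomial.C lam : Polynomial ℂ).degree = 3 := by
          compute_degree!
        rw [this]; norm_num)
    exact ⟨a, by simpa using ha⟩
  obtain ⟨s, hs⟩ := IsAlgClosed.exists_pow_nat_eq (-3 * a ^ 2 - 4) (n := 2) (by norm_num)
  obtain ⟨b, hb⟩ : ∃ b : ℂ, b = (-a + s) / 2 := ⟨_, rfl⟩
  have hab2 : a ^ 2 + a * b + b ^ 2 = -1 := by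
    rw [hb]; linear_combination hs / 4
  obtain ⟨c, hc⟩ : ∃ c : ℂ, c = -a - b := ⟨_, rfl⟩
  have hb3 : b ^ 3 + b + lam = 0 := by linear_combination ha + (b - a) * hab2
  have hc3 : c ^ 3 + c + lam = 0 := by
    rw [hc]; linear_combination ha + (-2 * a - b) * hab2
  have nab : a - b ≠ 0 := fun e =>
    no_double lam hre φ h a ha (by
      have : b = a := by linear_combination -e
      rw [this] at hab2; linear_combination hab2)
  have nac : a - c ≠ 0 := fun e =>
    no_double lam hre φ h a ha (by
      have : b = -2 * a := by linear_combination hc + e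
      rw [this] at hab2; linear_combination hab2)
  have nbc : b - c ≠ 0 := fun e =>
    no_double lam hre φ h b hb3 (by
      have : a = -2 * b := by linear_combination hc + e
      rw [this] at hab2; linear_combination hab2)
  obtain ⟨A, B, f1, f2, h0, ⟨x0, hx0, hne⟩, d0, hk⟩ := key lam hre φ h
  obtain ⟨ka, ka'⟩ := hk a ha
  obtain ⟨kb, kb'⟩ := hk b hb3
  obtain ⟨kc, kc'⟩ := hk c hc3
  have hA : A ≠ 0 := by
    intro hA
    have := formula φ f1 f2 A a b c x0
      (ka x0 hx0) (kb x0 hx0) (kc x0 hx0)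
    rw [hA, zero_mul] at this
    simp_all
  obtain ⟨m, hm⟩ := Complex.exp_eq_exp_iff_exists_int.1
    (mul_left_cancel₀ hA (ka'.symm.trans kb'))
  obtain ⟨n, hn⟩ := Complex.exp_eq_exp_iff_exists_int.1
    (mul_left_cancel₀ hA (kb'.symm.trans kc'))
  have L0 : (L : ℂ) ≠ 0 := by exact_mod_cast L_pos.ne'
  have hm' : a - b = 3 * w * m := by
    apply mul_right_cancel₀ L0; linear_combination hm - m * hwL
  have hn' : b - c = 3 * w * n := by
    apply mul_right_cancel₀ L0; linear_combination hn - n * hwL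
  have m0 : m ≠ 0 := by rintro rfl; exact nab (by simpa using hm')
  have n0 : n ≠ 0 := by rintro rfl; exact nbc (by simpa using hn')
  have mn0 : m + n ≠ 0 := by
    intro e
    have e' : (m : ℂ) + n = 0 := by exact_mod_cast e
    exact nac (by linear_combination hm' + hn' + 3 * w * e')
  have ea : a = w * (2 * m + n) := by
    linear_combination (2 * hm' + hn' + hc) / 3
  have eb : b = w * (n - m) := by
    linear_combination (-hm' + hn' + hc) / 3
  have h7 : m ^ 2 + m * n + n ^ 2 = 7 := by
    have : (m : ℂ) ^ 2 + m * n + n ^ 2 = 7 := by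
      rw [ea, eb] at hab2
      linear_combination -7 * hab2 + ((m : ℂ) ^ 2 + m * n + n ^ 2) * hw
    exact_mod_cast this
  have hl : 21 * lam = -w * ((2 * m + n) * (21 - (2 * m + n) ^ 2)) := by
    rw [ea] at ha
    linear_combination 21 * ha - w * (2 * m + n) ^ 3 * hw
  rcases int_sol m n h7 m0 n0 mn0 with e | e
  · right
    have e' : (2 * (m : ℂ) + n) * (21 - (2 * m + n) ^ 2) = 20 := by exact_mod_cast e
    rw [e'] at hl
    linear_combination (hl + hq) / 21
  · left
    have e' : (2 * (m : ℂ) + n) * (21 - (2 * m + n) ^ 2) = -20 := by exact_mod_cast e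
    rw [e'] at hl
    linear_combination (hl - hq) / 21

/-- exponential form of the eigenfunctions -/
noncomputable def EE (w : ℂ) (x : ℝ) : ℂ :=
  Θ * (Complex.exp (5 * w * x) - 3 * Complex.exp (-w * x) + 2 * Complex.exp (-4 * w * x))

lemma EE_shape (w lam : ℂ) (hre : lam.re = 0) (hw : 21 * w ^ 2 = -1) (hl : 21 * lam = 20 * w)
    (φ : ℝ → ℂ) (h : IsEigenfunction lam φ) :
    ∃ C : ℂ, ∀ x ∈ Set.Icc (0 : ℝ) L, φ x = C * EE w x := by
  have w0 : w ≠ 0 := by rintro rfl; norm_num at hw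
  obtain ⟨A, B, f1, f2, h0, -, d0, hk⟩ := key lam hre φ h
  obtain ⟨ka, -⟩ := hk (5 * w) (by linear_combination (125 * w * hw + hl) / 21)
  obtain ⟨kb, -⟩ := hk (-w) (by linear_combination (-w * hw + hl) / 21)
  obtain ⟨kc, -⟩ := hk (-4 * w) (by linear_combination (-64 * w * hw + hl) / 21)
  have T0 : (Θ : ℂ) ≠ 0 := by exact_mod_cast Th_pos.ne'
  refine ⟨A / (54 * w ^ 2 * Θ), fun x hx => ?_⟩
  have := formula φ f1 f2 A (5 * w) (-w) (-4 * w) x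
    (ka x hx) (kb x hx) (kc x hx)
  unfold EE
  generalize Complex.exp (5 * w * x) = e1 at *
  generalize Complex.exp (-w * x) = e2 at *
  generalize Complex.exp (-4 * w * x) = e3 at *
  field_simp
  apply mul_left_cancel₀ (mul_ne_zero (by norm_num : (3 : ℂ) ≠ 0) w0)
  linear_combination this

lemma EE_eig (w lam : ℂ) (hw : 21 * w ^ 2 = -1) (hl : 21 * lam = 20 * w)
    (hwL : 3 * w * L = 2 * Real.pi * Complex.I ∨ 3 * w * L = -(2 * Real.pi * Complex.I)) :
    IsEigenfunction lam (EE w) := by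
  have T0 : (Θ : ℂ) ≠ 0 := by exact_mod_cast Th_pos.ne'
  have hd : ∀ p s t : ℂ, deriv (fun x : ℝ => p * Complex.exp (5 * w * x)
      + s * Complex.exp (-w * x) + t * Complex.exp (-4 * w * x)) = fun x : ℝ =>
      (p * (5 * w)) * Complex.exp (5 * w * x)
      + (s * (-w)) * Complex.exp (-w * x) + (t * (-4 * w)) * Complex.exp (-4 * w * x) := by
    intro p s t
    funext x
    have := ((((hasDeriv_exp (5 * w) x).const_mul p).add ((hasDeriv_exp (-w) x).const_mul s)).add
      ((hasDeriv_exp (-4 * w) x).const_mul t)).deriv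
    simp only [mul_assoc] at this ⊢
    exact this
  have hE : EE w = (fun x : ℝ => Θ * Complex.exp (5 * w * x)
      + (-3 * Θ) * Complex.exp (-w * x) + (2 * Θ) * Complex.exp (-4 * w * x)) := by
    funext x; unfold EE; ring
  have hc : ContDiff ℝ 3 (EE w) := by
    have hx : ∀ r : ℂ, ContDiff ℝ 3 (fun x : ℝ => Complex.exp (r * x)) := fun r =>
      (contDiff_const.mul Complex.ofRealCLM.contDiff).cexp
    rw [hE]
    exact ((contDiff_const.mul (hx _)).add (contDiff_const.mul (hx _))).add
      (contDiff_const.mul (hx _))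
  have i1 : ∀ x ∈ Set.Icc (0 : ℝ) L, iteratedDerivWithin 1 (EE w) (Set.Icc 0 L) x =
      deriv (EE w) x := by
    intro x hx
    rw [iteratedDerivWithin_eq_iteratedDeriv (uniqueDiffOn_Icc L_pos)
      (hc.contDiffAt.of_le (by norm_num)) hx, iteratedDeriv_one]
  have i3 : ∀ x ∈ Set.Icc (0 : ℝ) L, iteratedDerivWithin 3 (EE w) (Set.Icc 0 L) x =
      deriv (deriv (deriv (EE w))) x := by
    intro x hx
    rw [iteratedDerivWithin_eq_iteratedDeriv (uniqueDiffOn_Icc L_pos) hc.contDiffAt hx,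
      iteratedDeriv_succ, iteratedDeriv_succ, iteratedDeriv_one]
  have mL : L ∈ Set.Icc (0 : ℝ) L := ⟨L_pos.le, le_rfl⟩
  -- half-period value
  have hv : Complex.exp (w * (L / 2 : ℝ)) ^ 3 = -1 := by
    rw [← Complex.exp_nat_mul]
    rcases hwL with e | e
    · rw [← Complex.exp_pi_mul_I]; congr 1; push_cast; linear_combination e / 2
    · rw [← inv_inj, ← Complex.exp_neg, inv_neg_one, ← Complex.exp_pi_mul_I]
      congr 1; push_cast; linear_combination -e / 2
  set v := Complex.exp (w * (L / 2 : ℝ)) with hvdef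
  have v0 : v ≠ 0 := Complex.exp_ne_zero _
  have p5 : ∀ k : ℕ, Complex.exp (k * (w * (L / 2 : ℝ))) = v ^ k := fun k => by
    rw [hvdef, ← Complex.exp_nat_mul]
  have n5 : ∀ k : ℕ, Complex.exp (-(k * (w * (L / 2 : ℝ)))) = (v ^ k)⁻¹ := fun k => by
    rw [Complex.exp_neg, p5]
  have v6 : v ^ 6 = 1 := by linear_combination (v ^ 3 - 1) * hv
  have x1 : Complex.exp (5 * w * L) = (v ^ 2)⁻¹ := by
    rw [show 5 * w * L = ((10 : ℕ) : ℂ) * (w * (L / 2 : ℝ)) by push_cast; ring, p5]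
    field_simp; linear_combination (v ^ 6 + 1) * v6
  have x2 : Complex.exp (-w * L) = (v ^ 2)⁻¹ := by
    rw [show -w * L = -(((2 : ℕ) : ℂ) * (w * (L / 2 : ℝ))) by push_cast; ring, n5]
  have x3 : Complex.exp (-4 * w * L) = (v ^ 2)⁻¹ := by
    rw [show -4 * w * L = -(((8 : ℕ) : ℂ) * (w * (L / 2 : ℝ))) by push_cast; ring, n5]
    rw [show v ^ 8 = v ^ 6 * v ^ 2 by ring, v6, one_mul]
  refine ⟨hc.contDiffOn, ⟨L / 2, ⟨by linarith [L_pos], by linarith [L_pos]⟩, ?_⟩, ?_, ?_, ?_, ?_⟩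
  · have y1 : Complex.exp (5 * w * (L / 2 : ℝ)) = v⁻¹ := by
      rw [show 5 * w * (L / 2 : ℝ) = ((5 : ℕ) : ℂ) * (w * (L / 2 : ℝ)) by push_cast; ring, p5]
      field_simp; linear_combination v6
    have y2 : Complex.exp (-w * (L / 2 : ℝ)) = v⁻¹ := by
      rw [show -w * (L / 2 : ℝ) = -(((1 : ℕ) : ℂ) * (w * (L / 2 : ℝ))) by push_cast; ring, n5,
        pow_one]
    have y3 : Complex.exp (-4 * w * (L / 2 : ℝ)) = -v⁻¹ := by
      rw [show -4 * w * (L / 2 : ℝ) = -(((4 : ℕ) : ℂ) * (w * (L / 2 : ℝ))) by push_cast; ring, n5,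
        show v ^ 4 = v ^ 3 * v by ring, hv, neg_one_mul, inv_neg]
    unfold EE
    rw [y1, y2, y3]
    rw [show (Θ : ℂ) * (v⁻¹ - 3 * v⁻¹ + 2 * -v⁻¹) = -4 * Θ * v⁻¹ by ring]
    simp [T0, v0]
  · intro x hx
    rw [i1 x hx, i3 x hx, hE]
    simp only [hd]
    generalize Complex.exp (5 * w * x) = e1
    generalize Complex.exp (-w * x) = e2
    generalize Complex.exp (-4 * w * x) = e3
    linear_combination (-(Θ * e1 + (-3 * Θ) * e2 + 2 * Θ * e3) / 21) * hl
      - (Θ * e1 * 125 * w + 3 * Θ * e2 * w - 128 * Θ * e3 * w) / 21 * hw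
  · simp [EE]; right; norm_num
  · unfold EE; rw [x1, x2, x3]; ring
  · rw [i1 L mL, hE, hd]; simp only []; rw [x1, x2, x3]; ring

lemma EE_minus (x : ℝ) : EE (Complex.I / (Real.sqrt 21 : ℂ)) x =
    (φ1 x : ℂ) - Complex.I * (φ2 x : ℂ) := by
  unfold EE φ1 φ2
  rw [show 5 * (Complex.I / (Real.sqrt 21 : ℂ)) * x = (5 * x / Real.sqrt 21 : ℝ) * Complex.I by
      push_cast; ring,
    show -(Complex.I / (Real.sqrt 21 : ℂ)) * x = (-(x / Real.sqrt 21) : ℝ) * Complex.I by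
      push_cast; ring,
    show -4 * (Complex.I / (Real.sqrt 21 : ℂ)) * x = (-(4 * x / Real.sqrt 21) : ℝ) * Complex.I by
      push_cast; ring]
  simp only [Complex.exp_mul_I, ← Complex.ofReal_cos, ← Complex.ofReal_sin, Real.cos_neg,
    Real.sin_neg]
  push_cast
  ring

lemma EE_plus (x : ℝ) : EE (-(Complex.I / (Real.sqrt 21 : ℂ))) x =
    (φ1 x : ℂ) + Complex.I * (φ2 x : ℂ) := by
  unfold EE φ1 φ2
  rw [show 5 * (-(Complex.I / (Real.sqrt 21 : ℂ))) * x
        = (-(5 * x / Real.sqrt 21) : ℝ) * Complex.I by push_cast; ring,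
    show -(-(Complex.I / (Real.sqrt 21 : ℂ))) * x = (x / Real.sqrt 21 : ℝ) * Complex.I by
      push_cast; ring,
    show -4 * (-(Complex.I / (Real.sqrt 21 : ℂ))) * x
        = (4 * x / Real.sqrt 21 : ℝ) * Complex.I by push_cast; ring]
  simp only [Complex.exp_mul_I, ← Complex.ofReal_cos, ← Complex.ofReal_sin, Real.cos_neg,
    Real.sin_neg]
  push_cast
  ring

/-- the only eigenvalues on the imaginary axis are ±i·q, with
eigenfunctions the complex scalar multiples of φ1 ∓ i·φ2. -/
theorem stmt_7 (lam : ℂ) (hre : lam.re = 0) :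
    ((∃ φ : ℝ → ℂ, IsEigenfunction lam φ) ↔
      (lam = Complex.I * (q : ℂ) ∨ lam = -Complex.I * (q : ℂ))) ∧
    (∀ φ : ℝ → ℂ, IsEigenfunction lam φ → lam = Complex.I * (q : ℂ) →
      ∃ C : ℂ, ∀ x ∈ Set.Icc (0 : ℝ) L, φ x = C * ((φ1 x : ℂ) - Complex.I * (φ2 x : ℂ))) ∧
    (∀ φ : ℝ → ℂ, IsEigenfunction lam φ → lam = -Complex.I * (q : ℂ) →
      ∃ C : ℂ, ∀ x ∈ Set.Icc (0 : ℝ) L, φ x = C * ((φ1 x : ℂ) + Complex.I * (φ2 x : ℂ))) := by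
  obtain ⟨w, hwd, hw, hq, hwL⟩ := w_facts
  refine ⟨⟨fun ⟨φ, h⟩ => forward lam hre φ h, ?_⟩, ?_, ?_⟩
  · rintro (h | h)
    · exact ⟨_, EE_eig w lam hw (by rw [h, hq]) (Or.inl hwL)⟩
    · exact ⟨_, EE_eig (-w) lam (by linear_combination hw)
        (by rw [h]; linear_combination -hq) (Or.inr (by linear_combination -hwL))⟩
  · intro φ h hl
    obtain ⟨C, hC⟩ := EE_shape w lam hre hw (by rw [hl, hq]) φ h
    exact ⟨C, fun x hx => by rw [hC x hx, hwd, EE_minus]⟩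
  · intro φ h hl
    obtain ⟨C, hC⟩ := EE_shape (-w) lam hre (by linear_combination hw)
      (by rw [hl]; linear_combination -hq) φ h
    exact ⟨C, fun x hx => by rw [hC x hx, hwd, EE_plus]⟩
end

section
/- There exists r > 0 such that, for every λ ∈ ℂ with λ ∉ {i·q, −i·q} for which there exists a three times continuously differentiable function φ : [0,L] → ℂ, not identically zero, satisfying −(φ'(x) + φ'''(x)) = λ·φ(x) for all x ∈ [0,L] together with the boundary conditions φ(0) = φ(L) = 0 and φ'(L) = 0, one has Re(λ) < −r. That is, all eigenvalues of the operator other than ±i·q have real parts uniformly bounded away from the imaginary axis. -/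
lemma L_sq : L ^ 2 = 4 * Real.pi ^ 2 * (7 / 3) := by
  unfold L; rw [mul_pow, Real.sq_sqrt (by norm_num)]; ring

lemma L_le : L ≤ 10 := by
  have h := L_sq
  have hp := Real.pi_lt_d2
  have hp0 := Real.pi_pos
  have := L_pos
  nlinarith

set_option maxHeartbeats 4000000 in
/-- the energy bound in real coordinates -/
lemma energy (a b : ℝ) (u1 u2 v1 v2 w1 w2 : ℝ → ℝ)
    (hu1 : ∀ x, HasDerivAt u1 (v1 x) x) (hu2 : ∀ x, HasDerivAt u2 (v2 x) x)
    (hv1 : ∀ x, HasDerivAt v1 (w1 x) x) (hv2 : ∀ x, HasDerivAt v2 (w2 x) x)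
    (hw1 : ∀ x, HasDerivAt w1 (-v1 x - (a * u1 x - b * u2 x)) x)
    (hw2 : ∀ x, HasDerivAt w2 (-v2 x - (a * u2 x + b * u1 x)) x)
    (h10 : u1 0 = 0) (h20 : u2 0 = 0) (h1L : u1 L = 0) (h2L : u2 L = 0)
    (g1L : v1 L = 0) (g2L : v2 L = 0)
    (hne : ∃ x ∈ Set.Icc 0 L, 0 < u1 x ^ 2 + u2 x ^ 2) :
    a ≤ 0 ∧ (a = 0 → v1 0 = 0 ∧ v2 0 = 0) ∧ (-1 ≤ a → |b| ≤ 10 ^ 12) := by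
  have hL := L_pos
  have hL10 := L_le
  have cu1 : Continuous u1 := continuous_iff_continuousAt.2 fun x => (hu1 x).continuousAt
  have cu2 : Continuous u2 := continuous_iff_continuousAt.2 fun x => (hu2 x).continuousAt
  have cv1 : Continuous v1 := continuous_iff_continuousAt.2 fun x => (hv1 x).continuousAt
  have cv2 : Continuous v2 := continuous_iff_continuousAt.2 fun x => (hv2 x).continuousAt
  have cw1 : Continuous w1 := continuous_iff_continuousAt.2 fun x => (hw1 x).continuousAt
  have cw2 : Continuous w2 := continuous_iff_continuousAt.2 fun x => (hw2 x).continuousAt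
  obtain ⟨N, hN⟩ : ∃ N, N = ∫ x in (0:ℝ)..L, (u1 x ^ 2 + u2 x ^ 2) := ⟨_, rfl⟩
  obtain ⟨P, hP⟩ : ∃ N, N = ∫ x in (0:ℝ)..L, (v1 x ^ 2 + v2 x ^ 2) := ⟨_, rfl⟩
  obtain ⟨S, hS⟩ : ∃ N, N = ∫ x in (0:ℝ)..L, x * (w1 x ^ 2 + w2 x ^ 2) := ⟨_, rfl⟩
  obtain ⟨X, hX⟩ : ∃ N, N = ∫ x in (0:ℝ)..L, x * (u1 x ^ 2 + u2 x ^ 2) := ⟨_, rfl⟩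
  have key : ∀ (F f : ℝ → ℝ) (c1 c2 c3 c4 : ℝ), (∀ x, HasDerivAt F (f x) x) → Continuous f →
      (∀ x ∈ Set.Icc 0 L, f x ≤ c1 * (u1 x ^ 2 + u2 x ^ 2) + c2 * (v1 x ^ 2 + v2 x ^ 2)
        + c3 * (x * (w1 x ^ 2 + w2 x ^ 2)) + c4 * (x * (u1 x ^ 2 + u2 x ^ 2))) →
      F L - F 0 ≤ c1 * N + c2 * P + c3 * S + c4 * X := by
    intro F f c1 c2 c3 c4 hF hf hle
    rw [← intervalIntegral.integral_eq_sub_of_hasDerivAt (fun x _ => hF x)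
      (hf.intervalIntegrable _ _)]
    refine (intervalIntegral.integral_mono_on hL.le (hf.intervalIntegrable _ _)
      (Continuous.intervalIntegrable (by fun_prop) _ _) hle).trans (le_of_eq ?_)
    rw [intervalIntegral.integral_add (Continuous.intervalIntegrable (by fun_prop) _ _)
        (Continuous.intervalIntegrable (by fun_prop) _ _),
      intervalIntegral.integral_add (Continuous.intervalIntegrable (by fun_prop) _ _)
        (Continuous.intervalIntegrable (by fun_prop) _ _),
      intervalIntegral.integral_add (Continuous.intervalIntegrable (by fun_prop) _ _)
        (Continuous.intervalIntegrable (by fun_prop) _ _)]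
    simp only [intervalIntegral.integral_const_mul]
    rw [hN, hP, hS, hX]
  have hNpos : 0 < N := by
    rw [hN]
    exact intervalIntegral.integral_pos hL (by fun_prop) (fun x _ => by positivity) hne
  have hPpos : 0 ≤ P := by
    rw [hP]; exact intervalIntegral.integral_nonneg hL.le (fun x _ => by positivity)
  -- energy identity
  have e1 := key (fun x => (w1 x * u1 x + w2 x * u2 x) - 1/2 * (v1 x ^ 2 + v2 x ^ 2)
      + 1/2 * (u1 x ^ 2 + u2 x ^ 2)) (fun x => -a * (u1 x ^ 2 + u2 x ^ 2)) (-a) 0 0 0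
    (fun x => by
      have := (((hw1 x).mul (hu1 x)).add ((hw2 x).mul (hu2 x))).sub
        ((((hv1 x).pow 2).add ((hv2 x).pow 2)).const_mul (1/2)) |>.add
        ((((hu1 x).pow 2).add ((hu2 x).pow 2)).const_mul (1/2))
      refine this.congr_deriv ?_
      push_cast; ring) (by fun_prop) (fun x _ => by apply le_of_eq; ring)
  have e1' := key (fun x => -((w1 x * u1 x + w2 x * u2 x) - 1/2 * (v1 x ^ 2 + v2 x ^ 2)
      + 1/2 * (u1 x ^ 2 + u2 x ^ 2))) (fun x => a * (u1 x ^ 2 + u2 x ^ 2)) a 0 0 0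
    (fun x => by
      have := ((((hw1 x).mul (hu1 x)).add ((hw2 x).mul (hu2 x))).sub
        ((((hv1 x).pow 2).add ((hv2 x).pow 2)).const_mul (1/2)) |>.add
        ((((hu1 x).pow 2).add ((hu2 x).pow 2)).const_mul (1/2))).neg
      refine this.congr_deriv ?_
      push_cast; ring) (by fun_prop) (fun x _ => by apply le_of_eq; ring)
  simp only [h10, h20, h1L, h2L, g1L, g2L] at e1 e1'
  ring_nf at e1 e1'
  have ha : a ≤ 0 := by
    by_contra h
    push Not at h
    nlinarith [mul_pos h hNpos, sq_nonneg (v1 0), sq_nonneg (v2 0)]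
  refine ⟨ha, ?_, ?_⟩
  · intro h
    subst h
    constructor <;> nlinarith [sq_nonneg (v1 0), sq_nonneg (v2 0)]
  intro ha1
  have e2 := key (fun x => x * ((w1 x * u1 x + w2 x * u2 x) - 1/2 * (v1 x ^ 2 + v2 x ^ 2)
      + 1/2 * (u1 x ^ 2 + u2 x ^ 2)) - (v1 x * u1 x + v2 x * u2 x))
      (fun x => -(3/2) * (v1 x ^ 2 + v2 x ^ 2) + 1/2 * (u1 x ^ 2 + u2 x ^ 2)
        - x * a * (u1 x ^ 2 + u2 x ^ 2)) (21/2) (-(3/2)) 0 0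
    (fun x => by
      have := ((hasDerivAt_id x).mul ((((hw1 x).mul (hu1 x)).add ((hw2 x).mul (hu2 x))).sub
        ((((hv1 x).pow 2).add ((hv2 x).pow 2)).const_mul (1/2)) |>.add
        ((((hu1 x).pow 2).add ((hu2 x).pow 2)).const_mul (1/2)))).sub
        (((hv1 x).mul (hu1 x)).add ((hv2 x).mul (hu2 x)))
      refine this.congr_deriv ?_
      simp only [Pi.add_apply, Pi.mul_apply, Pi.sub_apply, Pi.pow_apply, id]
      push_cast; ring) (by fun_prop) (fun x hx => by
        have h1 : x * (-a) ≤ 10 := by nlinarith [hx.1, hx.2]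
        nlinarith [mul_le_mul_of_nonneg_right h1 (by positivity : 0 ≤ u1 x ^ 2 + u2 x ^ 2)])
  simp only [h10, h20, h1L, h2L, g1L, g2L] at e2
  ring_nf at e2
  have hP7 : P ≤ 7 * N := by linarith
  have hb0 := abs_nonneg b
  have e3 := key (fun x => -(x * (w1 x * v1 x + w2 x * v2 x) - 1/2 * (v1 x ^ 2 + v2 x ^ 2)))
      (fun x => x * (v1 x ^ 2 + v2 x ^ 2) + x * ((a * u1 x - b * u2 x) * v1 x +
        (a * u2 x + b * u1 x) * v2 x) - x * (w1 x ^ 2 + w2 x ^ 2))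
      (5 * (|b| + 1)) (10 + 5 * (|b| + 1)) (-1) 0
    (fun x => by
      have := (((hasDerivAt_id x).mul (((hw1 x).mul (hv1 x)).add ((hw2 x).mul (hv2 x)))).sub
        ((((hv1 x).pow 2).add ((hv2 x).pow 2)).const_mul (1/2))).neg
      refine this.congr_deriv ?_
      simp only [Pi.add_apply, Pi.mul_apply, Pi.sub_apply, Pi.pow_apply, id]
      push_cast; ring) (by fun_prop) (fun x hx => by
        have h1 : a * (u1 x * v1 x + u2 x * v2 x) ≤
            1/2 * ((u1 x ^ 2 + u2 x ^ 2) + (v1 x ^ 2 + v2 x ^ 2)) := by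
          linarith [mul_nonneg (neg_nonneg.2 ha) (sq_nonneg (u1 x + v1 x)),
            mul_nonneg (neg_nonneg.2 ha) (sq_nonneg (u2 x + v2 x)),
            mul_nonneg (by linarith : 0 ≤ 1 + a) (sq_nonneg (u1 x)),
            mul_nonneg (by linarith : 0 ≤ 1 + a) (sq_nonneg (u2 x)),
            mul_nonneg (by linarith : 0 ≤ 1 + a) (sq_nonneg (v1 x)),
            mul_nonneg (by linarith : 0 ≤ 1 + a) (sq_nonneg (v2 x))]
        have h2 : b * (u1 x * v2 x - u2 x * v1 x) ≤
            |b| * (1/2 * ((u1 x ^ 2 + u2 x ^ 2) + (v1 x ^ 2 + v2 x ^ 2))) := by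
          refine (le_abs_self _).trans ?_
          rw [abs_mul]
          refine mul_le_mul_of_nonneg_left ?_ hb0
          rw [abs_le]
          constructor <;> nlinarith [sq_nonneg (u1 x + v2 x), sq_nonneg (u2 x - v1 x),
            sq_nonneg (u1 x - v2 x), sq_nonneg (u2 x + v1 x)]
        have hx0 := hx.1
        have hx10 : x ≤ 10 := hx.2.trans hL10
        have h3 := mul_le_mul_of_nonneg_left (add_le_add h1 h2) hx0
        have h4 := mul_le_mul_of_nonneg_right hx10
          (by positivity : 0 ≤ (|b| + 1) * (1/2 * ((u1 x ^ 2 + u2 x ^ 2) + (v1 x ^ 2 + v2 x ^ 2))))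
        have h5 := mul_le_mul_of_nonneg_right hx10
          (by positivity : 0 ≤ v1 x ^ 2 + v2 x ^ 2)
        linarith)
  have e4 := key (fun x => -(x * (u1 x ^ 2 + u2 x ^ 2)))
      (fun x => -(u1 x ^ 2 + u2 x ^ 2) - 2 * (x * (u1 x * v1 x + u2 x * v2 x)))
      (-1) (10/140) 0 140
    (fun x => by
      have := ((hasDerivAt_id x).mul (((hu1 x).pow 2).add ((hu2 x).pow 2))).neg
      refine this.congr_deriv ?_
      simp only [Pi.add_apply, Pi.mul_apply, Pi.sub_apply, Pi.pow_apply, id]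
      push_cast; ring) (by fun_prop) (fun x hx => by
        have hx0 := hx.1
        have hx10 : x ≤ 10 := hx.2.trans hL10
        have h5 := mul_le_mul_of_nonneg_right hx10
          (by positivity : 0 ≤ v1 x ^ 2 + v2 x ^ 2)
        have h6 := mul_nonneg hx0 (by positivity :
          0 ≤ (140 * u1 x + v1 x) ^ 2 + (140 * u2 x + v2 x) ^ 2)
        nlinarith)
  have dF : ∀ x, HasDerivAt (fun x => x * (w2 x * u1 x - w1 x * u2 x) - (v2 x * u1 x - v1 x * u2 x))
      (x * (v1 x * w2 x - v2 x * w1 x) - x * (u1 x * v2 x - u2 x * v1 x)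
        - b * (x * (u1 x ^ 2 + u2 x ^ 2))) x := fun x => by
    have := ((hasDerivAt_id x).mul (((hw2 x).mul (hu1 x)).sub ((hw1 x).mul (hu2 x)))).sub
      (((hv2 x).mul (hu1 x)).sub ((hv1 x).mul (hu2 x)))
    refine this.congr_deriv ?_
    simp only [Pi.add_apply, Pi.mul_apply, Pi.sub_apply, Pi.pow_apply, id]
    push_cast; ring
  have bd : ∀ x ∈ Set.Icc 0 L, |x * (v1 x * w2 x - v2 x * w1 x) - x * (u1 x * v2 x - u2 x * v1 x)| ≤
      5 * (u1 x ^ 2 + u2 x ^ 2) + (5 + 50000) * (v1 x ^ 2 + v2 x ^ 2)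
        + 1 / 20000 * (x * (w1 x ^ 2 + w2 x ^ 2)) := by
    intro x hx
    have hx0 := hx.1
    have hx10 : x ≤ 10 := hx.2.trans hL10
    have h5 := mul_le_mul_of_nonneg_right hx10
      (by positivity : 0 ≤ 5000 * (v1 x ^ 2 + v2 x ^ 2))
    have h7 := mul_le_mul_of_nonneg_right hx10
      (by positivity : 0 ≤ 1/2 * (u1 x ^ 2 + u2 x ^ 2 + v1 x ^ 2 + v2 x ^ 2))
    have h1 : |v1 x * w2 x - v2 x * w1 x| ≤ 5000 * (v1 x ^ 2 + v2 x ^ 2)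
        + 1 / 20000 * (w1 x ^ 2 + w2 x ^ 2) := by
      rw [abs_le]
      constructor <;> nlinarith [sq_nonneg (10000 * v1 x + w2 x), sq_nonneg (10000 * v1 x - w2 x),
        sq_nonneg (10000 * v2 x + w1 x), sq_nonneg (10000 * v2 x - w1 x)]
    have h2 : |u1 x * v2 x - u2 x * v1 x| ≤ 1/2 * (u1 x ^ 2 + u2 x ^ 2 + v1 x ^ 2 + v2 x ^ 2) := by
      rw [abs_le]
      constructor <;> nlinarith [sq_nonneg (u1 x + v2 x), sq_nonneg (u2 x - v1 x),
            sq_nonneg (u1 x - v2 x), sq_nonneg (u2 x + v1 x)]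
    have h3 := abs_sub (x * (v1 x * w2 x - v2 x * w1 x)) (x * (u1 x * v2 x - u2 x * v1 x))
    rw [abs_mul, abs_mul, abs_of_nonneg hx0] at h3
    have h1' := mul_le_mul_of_nonneg_left h1 hx0
    have h2' := mul_le_mul_of_nonneg_left h2 hx0
    linarith
  have e5 := key _ _ 5 (5 + 50000) (1/20000) (-b) dF (by fun_prop) (fun x hx => by
    have := (abs_le.1 (bd x hx)).2
    linarith)
  have e6 := key _ _ 5 (5 + 50000) (1/20000) b (fun x => (dF x).neg) (by fun_prop) (fun x hx => by
    have := (abs_le.1 (bd x hx)).1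
    linarith)
  simp only [h10, h20, h1L, h2L, g1L, g2L, Pi.neg_apply] at e3 e4 e5 e6
  ring_nf at e3 e4 e5 e6
  have hv0 : v1 0 ^ 2 + v2 0 ^ 2 ≤ 2 * N := by nlinarith
  have hbP := mul_le_mul_of_nonneg_left hP7 hb0
  have hS' : S ≤ 111 * N + 40 * (|b| * N) := by nlinarith
  have hNX : N ≤ 280 * X := by linarith
  have hbX : |b| * X ≤ 5 * N + 50005 * P + 1/20000 * S := by
    rcases abs_cases b with ⟨h, _⟩ | ⟨h, _⟩ <;> rw [h] <;> linarith
  have hbN := mul_le_mul_of_nonneg_left hNX hb0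
  have : |b| * N ≤ 10 ^ 12 * N := by linarith
  exact le_of_mul_le_mul_right this hNpos

lemma ode_const (f : ℝ → ℂ) (h : ∀ x, HasDerivAt f 0 x) : f L = f 0 :=
  is_const_of_deriv_eq_zero (fun x => (h x).differentiableAt) (fun x => (h x).deriv) _ _

lemma norm_seven (k l : ℤ) (h : k ^ 2 + k * l + l ^ 2 = 7) :
    (l - k) * (2 * k + l) * (2 * l + k) = 20 ∨ (l - k) * (2 * k + l) * (2 * l + k) = -20 := by
  have hk : k ≤ 3 := by nlinarith [sq_nonneg (k + 2 * l)]
  have hk' : -3 ≤ k := by nlinarith [sq_nonneg (k + 2 * l)]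
  have hl : l ≤ 3 := by nlinarith [sq_nonneg (l + 2 * k)]
  have hl' : -3 ≤ l := by nlinarith [sq_nonneg (l + 2 * k)]
  interval_cases k <;> interval_cases l <;> simp_all

lemma rosier (lam : ℂ) (u v w : ℝ → ℂ)
    (hu : ∀ x, HasDerivAt u (v x) x) (hv : ∀ x, HasDerivAt v (w x) x)
    (hw : ∀ x, HasDerivAt w (-v x - lam * u x) x)
    (hu0 : u 0 = 0) (huL : u L = 0) (hv0 : v 0 = 0) (hvL : v L = 0) (hwL : w L ≠ 0) :
    lam = Complex.I * (q : ℂ) ∨ lam = -Complex.I * (q : ℂ) := by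
  have hLpos := L_pos
  have hLC : (L : ℂ) ≠ 0 := by exact_mod_cast hLpos.ne'
  have dexp : ∀ (ν : ℂ) (x : ℝ), HasDerivAt (fun x : ℝ => Complex.exp (-ν * x))
      (Complex.exp (-ν * x) * (-ν)) x := by
    intro ν x
    have h1 : HasDerivAt (fun z : ℂ => -ν * z) (-ν) (x : ℂ) := by
      simpa using (hasDerivAt_id (x : ℂ)).const_mul (-ν)
    exact (h1.cexp).comp_ofReal
  have hx' : ∀ x : ℝ, HasDerivAt (fun x : ℝ => (x : ℂ)) 1 x := fun x =>
    (hasDerivAt_id (x : ℂ)).comp_ofReal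
  -- first integral
  have hG : ∀ ν : ℂ, ν ^ 3 + ν + lam = 0 → Complex.exp (-ν * L) * w L = w 0 := by
    intro ν hν
    have := ode_const (fun x => Complex.exp (-ν * x) * (w x + ν * v x + (ν ^ 2 + 1) * u x))
      (fun x => by
        refine ((dexp ν x).mul (((hw x).add ((hv x).const_mul ν)).add
          ((hu x).const_mul (ν ^ 2 + 1)))).congr_deriv ?_
        simp only [Pi.add_apply]
        linear_combination (-Complex.exp (-ν * x) * u x) * hν)
    simpa [hu0, huL, hv0, hvL] using this
  have hH : ∀ ν : ℂ, ν ^ 3 + ν + lam = 0 → 3 * ν ^ 2 + 1 = 0 → False := by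
    intro ν hν hν2
    have := ode_const (fun x => Complex.exp (-ν * x) * (v x + 2 * ν * u x -
        x * (w x + ν * v x + (ν ^ 2 + 1) * u x)))
      (fun x => by
        refine ((dexp ν x).mul (((hv x).add ((hu x).const_mul (2 * ν))).sub
          ((hx' x).mul (((hw x).add ((hv x).const_mul ν)).add
          ((hu x).const_mul (ν ^ 2 + 1)))))).congr_deriv ?_
        simp only [Pi.add_apply, Pi.sub_apply, Pi.mul_apply]
        linear_combination (Complex.exp (-ν * x) * x * u x) * hν
          - (Complex.exp (-ν * x) * u x) * hν2)
    simp [hu0, huL, hv0, hvL, hLpos.ne', hwL] at this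
  -- the roots
  obtain ⟨ν, hν⟩ : ∃ ν : ℂ, ν ^ 3 + ν + lam = 0 := by
    obtain ⟨z, hz⟩ := IsAlgClosed.exists_root
      (Polynomial.X ^ 3 + Polynomial.X + Polynomial.C lam : Polynomial ℂ) (by
        have : (Polynomial.X ^ 3 + Polynomial.X + Polynomial.C lam : Polynomial ℂ).degree = 3 := by
          compute_degree!
        rw [this]; norm_num)
    exact ⟨z, by simpa using hz⟩
  obtain ⟨s, hs⟩ := IsAlgClosed.exists_pow_nat_eq (-3 * ν ^ 2 - 4) (n := 2) (by norm_num)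
  have h2 : ((-ν + s) / 2) ^ 3 + (-ν + s) / 2 + lam = 0 := by
    linear_combination hν + (-3 * ν + s) / 8 * hs
  have h3 : ((-ν - s) / 2) ^ 3 + (-ν - s) / 2 + lam = 0 := by
    linear_combination hν + (-3 * ν - s) / 8 * hs
  have quant : ∀ α β : ℂ, α ^ 3 + α + lam = 0 → β ^ 3 + β + lam = 0 →
      ∃ n : ℤ, α = β + n * (2 * Real.pi * Complex.I / L) := by
    intro α β hα hβ
    have h := (hG α hα).trans (hG β hβ).symm
    obtain ⟨n, hn⟩ := Complex.exp_eq_exp_iff_exists_int.1 (mul_right_cancel₀ hwL h)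
    refine ⟨-n, ?_⟩
    field_simp
    push_cast
    linear_combination -hn
  obtain ⟨k, hk⟩ := quant _ _ hν h2
  obtain ⟨l, hl⟩ := quant _ _ h2 h3
  obtain ⟨δ, hδ⟩ : ∃ δ : ℂ, δ = 2 * Real.pi * Complex.I / L := ⟨_, rfl⟩
  rw [← hδ] at hk hl
  have hsC : (L : ℂ) = 2 * Real.pi * (Real.sqrt (7/3) : ℝ) := by
    unfold L; push_cast; ring
  have hpi : (Real.pi : ℂ) ≠ 0 := by exact_mod_cast Real.pi_ne_zero
  have hr0 : ((Real.sqrt (7/3) : ℝ) : ℂ) ≠ 0 := by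
    have : Real.sqrt (7/3) ≠ 0 := by positivity
    exact_mod_cast this
  have hr2 : ((Real.sqrt (7/3) : ℝ) : ℂ) ^ 2 = 7 / 3 := by
    have : Real.sqrt (7/3) ^ 2 = 7 / 3 := Real.sq_sqrt (by norm_num)
    rw [← Complex.ofReal_pow, this]; push_cast; rfl
  have hδr : δ * (Real.sqrt (7/3) : ℝ) = Complex.I := by
    rw [hδ, hsC]; field_simp
  have hδ2 : δ ^ 2 = -(3 / 7) := by
    have : δ ^ 2 * (7 / 3) = -1 := by
      rw [← hr2, ← mul_pow, hδr, Complex.I_sq]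
    linear_combination 3 / 7 * this
  have hs' : s = l * δ := by linear_combination hl
  have hν' : ν = (2 * k + l) * δ / 3 := by linear_combination 2 / 3 * hk + 1 / 3 * hs'
  have hkl : k ^ 2 + k * l + l ^ 2 = 7 := by
    have : (k : ℂ) ^ 2 + k * l + l ^ 2 = 7 := by
      rw [hs', hν'] at hs
      linear_combination (-7/4) * hs + (7 / 4 * l ^ 2 + 7 / 12 * (2 * k + l) ^ 2) * hδ2
    exact_mod_cast this
  have hlam : lam = δ ^ 3 * ((l - k) * (2 * k + l) * (2 * l + k)) / 27 := by
    rw [hν'] at hν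
    have hkl' : (k : ℂ) ^ 2 + k * l + l ^ 2 = 7 := by exact_mod_cast hkl
    linear_combination hν - (2 * k + l) * δ / 3 * (7 / 3 * hδ2 + δ ^ 2 / 3 * hkl')
  have hqδ : δ ^ 3 * 20 / 27 = -Complex.I * q := by
    have e : (q : ℂ) * (Real.sqrt (7/3) : ℝ) = 20 / 63 := by
      have : q * Real.sqrt (7/3) = 20 / 63 := by
        have h21 : Real.sqrt 21 = 3 * Real.sqrt (7/3) := by
          rw [show (21:ℝ) = 3 ^ 2 * (7/3) by norm_num, Real.sqrt_mul (by norm_num),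
            Real.sqrt_sq (by norm_num)]
        have : Real.sqrt (7/3) ≠ 0 := by positivity
        unfold q; rw [h21]; field_simp; norm_num
      rw [← Complex.ofReal_mul, this]; push_cast; rfl
    apply mul_right_cancel₀ hr0
    linear_combination (20 / 27 * δ ^ 2) * hδr + 20 / 27 * Complex.I * hδ2 + Complex.I * e
  rcases norm_seven k l hkl with h | h
  · right
    have h' : ((l - k) * (2 * k + l) * (2 * l + k) : ℂ) = 20 := by exact_mod_cast h
    rw [hlam, h', hqδ]
  · left
    have h' : ((l - k) * (2 * k + l) * (2 * l + k) : ℂ) = -20 := by exact_mod_cast h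
    rw [hlam, h']
    linear_combination -hqδ

/-- the first order system as a bounded operator -/
noncomputable def Aop (lam : ℂ) : (ℂ × ℂ × ℂ) →L[ℂ] (ℂ × ℂ × ℂ) :=
  ((ContinuousLinearMap.fst ℂ ℂ ℂ).comp (ContinuousLinearMap.snd ℂ ℂ (ℂ × ℂ))).prod
    (((ContinuousLinearMap.snd ℂ ℂ ℂ).comp (ContinuousLinearMap.snd ℂ ℂ (ℂ × ℂ))).prod
      (-((ContinuousLinearMap.fst ℂ ℂ ℂ).comp (ContinuousLinearMap.snd ℂ ℂ (ℂ × ℂ)))))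
  + lam • ((0 : (ℂ × ℂ × ℂ) →L[ℂ] ℂ).prod ((0 : (ℂ × ℂ × ℂ) →L[ℂ] ℂ).prod
      (-(ContinuousLinearMap.fst ℂ ℂ (ℂ × ℂ)))))

lemma Aop_apply (lam : ℂ) (y : ℂ × ℂ × ℂ) :
    Aop lam y = (y.2.1, y.2.2, -y.2.1 - lam * y.1) := by
  simp [Aop, sub_eq_add_neg]

/-- the fundamental solution -/
noncomputable def sol (lam : ℂ) (x : ℝ) : ℂ × ℂ × ℂ :=
  NormedSpace.exp (((x : ℂ) - L) • Aop lam) ((0, 0, 1) : ℂ × ℂ × ℂ)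

lemma sol_L (lam : ℂ) : sol lam L = (0, 0, 1) := by
  have h : (0 : ℂ) • Aop lam = 0 := ContinuousLinearMap.ext fun y => by
    rw [ContinuousLinearMap.smul_apply, zero_smul]; rfl
  unfold sol
  rw [sub_self, h, NormedSpace.exp_zero]; rfl

lemma sol_deriv (lam : ℂ) (x : ℝ) : HasDerivAt (sol lam) (Aop lam (sol lam x)) x := by
  have h1 : HasDerivAt (fun z : ℂ => NormedSpace.exp (z • Aop lam))
      (Aop lam * NormedSpace.exp (((x : ℂ) - L) • Aop lam)) ((x : ℂ) - L) :=
    hasDerivAt_exp_smul_const' (𝕂 := ℂ) (Aop lam) _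
  have h2 : HasDerivAt (fun z : ℂ => NormedSpace.exp ((z - L) • Aop lam))
      (Aop lam * NormedSpace.exp (((x : ℂ) - L) • Aop lam)) (x : ℂ) :=
    HasDerivAt.comp_sub_const (x : ℂ) (L : ℂ) h1
  have h3 := h2.clm_apply (hasDerivAt_const (x : ℂ) ((0, 0, 1) : ℂ × ℂ × ℂ))
  have h4 := h3.scomp x ((hasDerivAt_id (x : ℂ)).comp_ofReal)
  refine h4.congr_deriv ?_
  rw [map_zero, add_zero, one_smul]
  rfl

lemma sol_d (lam : ℂ) : (∀ x, HasDerivAt (fun x => (sol lam x).1) (sol lam x).2.1 x) ∧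
    (∀ x, HasDerivAt (fun x => (sol lam x).2.1) (sol lam x).2.2 x) ∧
    (∀ x, HasDerivAt (fun x => (sol lam x).2.2) (-(sol lam x).2.1 - lam * (sol lam x).1) x) := by
  have h := sol_deriv lam
  simp only [Aop_apply] at h
  have h2 := fun x => (hasFDerivAt_snd (𝕜 := ℝ) (p := sol lam x)).comp_hasDerivAt x (h x)
  refine ⟨fun x => ?_, fun x => ?_, fun x => ?_⟩
  · exact (hasFDerivAt_fst (𝕜 := ℝ) (p := sol lam x)).comp_hasDerivAt x (h x)
  · exact (hasFDerivAt_fst (𝕜 := ℝ) (p := (sol lam x).2)).comp_hasDerivAt x (h2 x)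
  · exact (hasFDerivAt_snd (𝕜 := ℝ) (p := (sol lam x).2)).comp_hasDerivAt x (h2 x)

/-- characteristic function -/
noncomputable def charF (lam : ℂ) : ℂ := (sol lam 0).1

lemma charF_diff : Differentiable ℂ charF := by
  have h1 : Differentiable ℂ (fun lam : ℂ => (((0 : ℝ) : ℂ) - L) • Aop lam) := by
    unfold Aop
    fun_prop
  have h2 : Differentiable ℂ (fun lam : ℂ => NormedSpace.exp ((((0 : ℝ) : ℂ) - L) • Aop lam)) :=
    fun z => ((NormedSpace.exp_analytic (𝕂 := ℂ) _).differentiableAt).comp z (h1 z)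
  have h3 : Differentiable ℂ (fun lam : ℂ => sol lam 0) :=
    h2.clm_apply (differentiable_const _)
  exact h3.fst

lemma sol_ne (lam : ℂ) : ∃ x ∈ Set.Icc 0 L, (sol lam x).1 ≠ 0 := by
  by_contra hcon
  push Not at hcon
  obtain ⟨h0, h1, h2⟩ := sol_d lam
  have aux : ∀ f f' : ℝ → ℂ, (∀ x, HasDerivAt f (f' x) x) → (∀ x ∈ Set.Icc 0 L, f x = 0) →
      ∀ x ∈ Set.Icc 0 L, f' x = 0 := by
    intro f f' hf hz x hx
    have a1 := (hf x).hasDerivWithinAt (s := Set.Icc 0 L)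
    have a2 : HasDerivWithinAt f 0 (Set.Icc 0 L) x :=
      (hasDerivWithinAt_const x _ (0 : ℂ)).congr hz (hz x hx)
    exact (uniqueDiffOn_Icc L_pos x hx).eq_deriv _ a1 a2
  have := aux _ _ h1 (aux _ _ h0 hcon) L ⟨L_pos.le, le_rfl⟩
  rw [sol_L] at this
  simp at this

lemma sol_energy (lam : ℂ) (h : charF lam = 0) :
    lam.re ≤ 0 ∧ (lam.re = 0 → (sol lam 0).2.1 = 0) ∧ (-1 ≤ lam.re → |lam.im| ≤ 10 ^ 12) := by
  obtain ⟨h0, h1, h2⟩ := sol_d lam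
  have hre : ∀ (f : ℝ → ℂ) (f' : ℂ) (x : ℝ), HasDerivAt f f' x →
      HasDerivAt (fun x => (f x).re) f'.re x := fun f f' x hf =>
    (Complex.reCLM.hasFDerivAt).comp_hasDerivAt x hf
  have him : ∀ (f : ℝ → ℂ) (f' : ℂ) (x : ℝ), HasDerivAt f f' x →
      HasDerivAt (fun x => (f x).im) f'.im x := fun f f' x hf =>
    (Complex.imCLM.hasFDerivAt).comp_hasDerivAt x hf
  have hL := sol_L lam
  unfold charF at h
  have := energy lam.re lam.im _ _ _ _ _ _ (fun x => hre _ _ x (h0 x)) (fun x => him _ _ x (h0 x))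
    (fun x => hre _ _ x (h1 x)) (fun x => him _ _ x (h1 x))
    (fun x => (hre _ _ x (h2 x)).congr_deriv (by simp))
    (fun x => (him _ _ x (h2 x)).congr_deriv (by simp))
    (by simp [h]) (by simp [h]) (by simp [hL]) (by simp [hL]) (by simp [hL]) (by simp [hL])
    (by
      obtain ⟨x, hx, hx0⟩ := sol_ne lam
      refine ⟨x, hx, ?_⟩
      have := Complex.normSq_pos.2 hx0
      rw [Complex.normSq_apply] at this
      nlinarith)
  refine ⟨this.1, fun hh => ?_, this.2.2⟩
  exact Complex.ext (this.2.1 hh).1 (this.2.1 hh).2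

lemma eig_charF (lam : ℂ) (φ : ℝ → ℂ) (hφ : ContDiffOn ℝ 3 φ (Set.Icc 0 L))
    (hne : ∃ x ∈ Set.Icc (0 : ℝ) L, φ x ≠ 0)
    (hode : ∀ x ∈ Set.Icc (0 : ℝ) L,
          -(iteratedDerivWithin 1 φ (Set.Icc 0 L) x + iteratedDerivWithin 3 φ (Set.Icc 0 L) x)
            = lam * φ x)
    (h0 : φ 0 = 0) (hL : φ L = 0) (hL' : iteratedDerivWithin 1 φ (Set.Icc 0 L) L = 0) :
    charF lam = 0 := by
  have hLpos := L_pos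
  have hd : ∀ m : ℕ, m < 3 → ∀ x ∈ Set.Icc 0 L, HasDerivWithinAt
      (iteratedDerivWithin m φ (Set.Icc 0 L)) (iteratedDerivWithin (m + 1) φ (Set.Icc 0 L) x)
      (Set.Icc 0 L) x := by
    intro m hm x hx
    rw [iteratedDerivWithin_succ]
    exact (hφ.differentiableOn_iteratedDerivWithin (by exact_mod_cast hm)
      (uniqueDiffOn_Icc hLpos) x hx).hasDerivWithinAt
  have hd0 := hd 0 (by norm_num)
  rw [iteratedDerivWithin_zero] at hd0
  have hd1 := hd 1 (by norm_num)
  have hd2 := hd 2 (by norm_num)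
  rw [show 0 + 1 = 1 from rfl] at hd0
  rw [show 1 + 1 = 2 from rfl] at hd1
  rw [show 2 + 1 = 3 from rfl] at hd2
  set f1 := iteratedDerivWithin 1 φ (Set.Icc 0 L)
  set f2 := iteratedDerivWithin 2 φ (Set.Icc 0 L)
  set f3 := iteratedDerivWithin 3 φ (Set.Icc 0 L)
  have hY : ∀ x ∈ Set.Icc 0 L, HasDerivWithinAt (fun x => (φ x, f1 x, f2 x))
      (Aop lam (φ x, f1 x, f2 x)) (Set.Icc 0 L) x := by
    intro x hx
    rw [Aop_apply]
    have e : -f1 x - lam * φ x = f3 x := by linear_combination hode x hx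
    simp only [e]
    exact (hd0 x hx).prodMk ((hd1 x hx).prodMk (hd2 x hx))
  have hS : ∀ x, HasDerivAt (fun x => f2 L • sol lam x) (Aop lam (f2 L • sol lam x)) x := by
    intro x
    rw [map_smul]
    exact (sol_deriv lam x).const_smul (f2 L)
  have huniq : Set.EqOn (fun x => (φ x, f1 x, f2 x)) (fun x => f2 L • sol lam x)
      (Set.Icc 0 L) := by
    refine ODE_solution_unique_of_mem_Icc_left (v := fun _ y => Aop lam y) (s := fun _ => Set.univ)
      (K := ‖Aop lam‖₊) (fun t _ => (Aop lam).lipschitz.lipschitzOnWith)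
      (fun x hx => (hY x hx).continuousWithinAt) (fun x hx => ?_) (fun _ _ => trivial)
      (fun x hx => (hS x).continuousAt.continuousWithinAt)
      (fun x hx => (hS x).hasDerivWithinAt) (fun _ _ => trivial) ?_
    · refine (hY x ⟨hx.1.le, hx.2⟩).mono_of_mem_nhdsWithin ?_
      exact mem_nhdsWithin.2 ⟨Set.Ioi 0, isOpen_Ioi, hx.1,
        fun y hy => ⟨le_of_lt hy.1, le_trans hy.2 hx.2⟩⟩
    · simp [sol_L, hL, hL']
  have hc : f2 L ≠ 0 := by
    intro hc
    obtain ⟨x, hx, hx0⟩ := hne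
    have := huniq hx
    simp [hc] at this
    exact hx0 this.1
  have := congrArg Prod.fst (huniq ⟨le_rfl, hLpos.le⟩)
  simp [h0, hc] at this
  exact this

lemma zeros_finite (R : ℝ) : (Metric.closedBall (0 : ℂ) R ∩ {z | charF z = 0}).Finite := by
  by_contra hinf
  obtain ⟨z, -, hz⟩ := Set.Infinite.exists_accPt_of_subset_isCompact hinf
    (isCompact_closedBall (0 : ℂ) R) Set.inter_subset_left
  have hfreq : ∃ᶠ w in nhdsWithin z {z}ᶜ, charF w = 0 := by
    rw [accPt_iff_frequently_nhdsNE] at hz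
    exact hz.mono fun w hw => hw.2
  have han : AnalyticOnNhd ℂ charF Set.univ := fun z _ => charF_diff.analyticAt z
  have h1 := han.eqOn_zero_of_preconnected_of_frequently_eq_zero isPreconnected_univ
    (Set.mem_univ z) hfreq (Set.mem_univ 1)
  have := (sol_energy 1 h1).1
  norm_num at this
/-- all eigenvalues of φ ↦ −φ' − φ''' (with boundary conditions
φ(0) = φ(L) = 0, φ'(L) = 0) other than ±i·q have real parts uniformly bounded
away from the imaginary axis. -/
theorem stmt_10 :
    ∃ r > (0 : ℝ), ∀ lam : ℂ,
      lam ≠ Complex.I * (q : ℂ) → lam ≠ -Complex.I * (q : ℂ) →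
      (∃ φ : ℝ → ℂ,
        ContDiffOn ℝ 3 φ (Set.Icc 0 L) ∧
        (∃ x ∈ Set.Icc (0 : ℝ) L, φ x ≠ 0) ∧
        (∀ x ∈ Set.Icc (0 : ℝ) L,
          -(iteratedDerivWithin 1 φ (Set.Icc 0 L) x + iteratedDerivWithin 3 φ (Set.Icc 0 L) x)
            = lam * φ x) ∧
        φ 0 = 0 ∧ φ L = 0 ∧ iteratedDerivWithin 1 φ (Set.Icc 0 L) L = 0) →
      lam.re < -r := by
  have hfin := zeros_finite (10 ^ 12 + 1)
  have hneg : ∀ lam : ℂ, lam ≠ Complex.I * (q : ℂ) → lam ≠ -Complex.I * (q : ℂ) →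
      charF lam = 0 → lam.re < 0 := by
    intro lam h1 h2 h
    obtain ⟨a, b, -⟩ := sol_energy lam h
    refine lt_of_le_of_ne a fun h0 => ?_
    obtain ⟨d0, d1, d2⟩ := sol_d lam
    have hL := sol_L lam
    rcases rosier lam _ _ _ d0 d1 d2 h (by simp [hL]) (b h0) (by simp [hL]) (by simp [hL])
      with h | h
    · exact h1 h
    · exact h2 h
  have hev : ∀ᶠ r in nhdsWithin (0 : ℝ) (Set.Ioi 0),
      ∀ lam ∈ Metric.closedBall (0 : ℂ) (10 ^ 12 + 1) ∩ {z | charF z = 0},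
        lam ≠ Complex.I * (q : ℂ) → lam ≠ -Complex.I * (q : ℂ) → lam.re < -r := by
    rw [hfin.eventually_all]
    intro lam hlam
    by_cases h1 : lam = Complex.I * (q : ℂ)
    · exact Filter.Eventually.of_forall fun r h => absurd h1 h
    by_cases h2 : lam = -Complex.I * (q : ℂ)
    · exact Filter.Eventually.of_forall fun r _ h => absurd h2 h
    have := hneg lam h1 h2 hlam.2
    filter_upwards [Ioo_mem_nhdsGT (show (0 : ℝ) < -lam.re by linarith)] with r hr _ _
    linarith [hr.2]
  obtain ⟨r, hr, hr01⟩ := (hev.and (Ioo_mem_nhdsGT (show (0 : ℝ) < 1 by norm_num))).exists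
  refine ⟨r, hr01.1, ?_⟩
  rintro lam h1 h2 ⟨φ, hφ, hne, hode, h0, hL, hL'⟩
  have hF := eig_charF lam φ hφ hne hode h0 hL hL'
  by_contra hcon
  push Not at hcon
  obtain ⟨a, -, b⟩ := sol_energy lam hF
  have hge : -1 ≤ lam.re := by linarith [hr01.2]
  have him := b hge
  have hmem : lam ∈ Metric.closedBall (0 : ℂ) (10 ^ 12 + 1) := by
    rw [mem_closedBall_zero_iff]
    have := Complex.norm_le_abs_re_add_abs_im lam
    have h3 : |lam.re| ≤ 1 := abs_le.2 ⟨hge, by linarith⟩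
    linarith
  linarith [hr lam ⟨hmem, hF⟩ h1 h2]
end
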